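/- arXiv:1703.10567 — 3 statements merged into one kernel-verified Lean document; each statement's English description precedes it below -/
import Mathlib

section
/- Let N ≥ 3 and let μ be a positive C^2 density on ℝ^N \ {0} with μ^{1/2} ∈ H^1_loc and Δμ ∈ L^1_loc. Then for every φ ∈ C_c^∞(ℝ^N), c_0(N) ∫ φ^2/|x|^2 μ dx ≤ ∫ |∇φ|^2 μ dx + ∫ U_μ φ^2 μ dx, where U_μ = (1/4)|∇μ/μ|^2 - (1/2)Δμ/μ and c_0(N) = ((N-2)/2)^2. -/
open MeasureTheory Metric Filter Set

noncomputable section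

/-- The Laplacian of a scalar function on Euclidean space, as the sum of the
second derivatives along the coordinate directions. -/
def lap {N : ℕ} (f : EuclideanSpace ℝ (Fin N) → ℝ) (x : EuclideanSpace ℝ (Fin N)) : ℝ :=
  ∑ i, fderiv ℝ (fun y => fderiv ℝ f y (EuclideanSpace.single i 1)) x (EuclideanSpace.single i 1)

/-- The Schrödinger potential `U_μ = (1/4)|∇μ/μ|² - (1/2)Δμ/μ` associated to a weight μ. -/
def Umu {N : ℕ} (μ : EuclideanSpace ℝ (Fin N) → ℝ) (x : EuclideanSpace ℝ (Fin N)) : ℝ :=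
  (1 / 4) * ‖gradient μ x‖ ^ 2 / μ x ^ 2 - (1 / 2) * lap μ x / μ x

open scoped Topology ContDiff

/-- The partial derivative of `f` in the `i`-th coordinate direction. -/
def pd {N : ℕ} (f : EuclideanSpace ℝ (Fin N) → ℝ) (i : Fin N)
    (x : EuclideanSpace ℝ (Fin N)) : ℝ :=
  fderiv ℝ f x (EuclideanSpace.single i 1)

/-- A smooth radially increasing function that vanishes for `n‖x‖ ≤ 1` and equals one for
`n²‖x‖² ≥ 2`. -/
def cutoff {N : ℕ} (n : ℕ) (x : EuclideanSpace ℝ (Fin N)) : ℝ :=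
  Real.smoothTransition ((n : ℝ) ^ 2 * ‖x‖ ^ 2 - 1)

/-- The expansion of `|∇(φ √μ)|²`. -/
def energyDensity {N : ℕ} (μ φ : EuclideanSpace ℝ (Fin N) → ℝ)
    (x : EuclideanSpace ℝ (Fin N)) : ℝ :=
  ∑ i, (pd φ i x ^ 2 * μ x + φ x * pd φ i x * pd μ i x + φ x ^ 2 * (pd μ i x ^ 2 / (4 * μ x)))

/-! ### Partial derivatives -/

section PartialDerivatives

variable {N : ℕ} {f g : EuclideanSpace ℝ (Fin N) → ℝ} {x : EuclideanSpace ℝ (Fin N)}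

lemma gradient_apply_eq_pd (f : EuclideanSpace ℝ (Fin N) → ℝ) (x : EuclideanSpace ℝ (Fin N))
    (i : Fin N) : gradient f x i = pd f i x := by
  rw [pd, ← toDual_gradient, InnerProductSpace.toDual_apply_apply, real_inner_comm,
    EuclideanSpace.inner_single_left]
  simp

lemma norm_gradient_sq (f : EuclideanSpace ℝ (Fin N) → ℝ) (x : EuclideanSpace ℝ (Fin N)) :
    ‖gradient f x‖ ^ 2 = ∑ i, pd f i x ^ 2 := by
  rw [EuclideanSpace.real_norm_sq_eq]
  simp only [gradient_apply_eq_pd]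

lemma pd_mul (hf : DifferentiableAt ℝ f x) (hg : DifferentiableAt ℝ g x) (i : Fin N) :
    pd (fun y => f y * g y) i x = f x * pd g i x + g x * pd f i x := by
  simp [pd, fderiv_fun_mul hf hg]

lemma pd_sq (hf : DifferentiableAt ℝ f x) (i : Fin N) :
    pd (fun y => f y ^ 2) i x = 2 * f x * pd f i x := by
  simp only [sq, pd_mul hf hf]
  ring

lemma pd_coord_div_norm_sq (hx : x ≠ 0) (i : Fin N) :
    pd (fun y : EuclideanSpace ℝ (Fin N) => y i / ‖y‖ ^ 2) i x =
      1 / ‖x‖ ^ 2 - 2 * x i ^ 2 / (‖x‖ ^ 2) ^ 2 := by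
  have hr : ‖x‖ ^ 2 ≠ 0 := by positivity
  have h1 : HasFDerivAt (fun y : EuclideanSpace ℝ (Fin N) => y i)
      (EuclideanSpace.proj i : EuclideanSpace ℝ (Fin N) →L[ℝ] ℝ) x :=
    (EuclideanSpace.proj i : EuclideanSpace ℝ (Fin N) →L[ℝ] ℝ).hasFDerivAt
  have h2 := (hasStrictFDerivAt_norm_sq x).hasFDerivAt
  have h : HasFDerivAt (fun y : EuclideanSpace ℝ (Fin N) => y i * (‖y‖ ^ 2)⁻¹) _ x :=
    h1.mul ((hasDerivAt_inv hr).comp_hasFDerivAt x h2)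
  simp only [div_eq_mul_inv, pd]
  rw [h.fderiv]
  simp [EuclideanSpace.inner_single_right]
  field_simp
  ring

lemma ContDiffOn.differentiableAt_of_ne_zero (hf : ContDiffOn ℝ 1 f {0}ᶜ) (hx : x ≠ 0) :
    DifferentiableAt ℝ f x :=
  (hf.differentiableOn (by simp)).differentiableAt (isOpen_compl_singleton.mem_nhds hx)

lemma ContDiffOn.continuousOn_pd (hf : ContDiffOn ℝ 1 f {0}ᶜ) (i : Fin N) :
    ContinuousOn (pd f i) {0}ᶜ :=
  (hf.continuousOn_fderiv_of_isOpen isOpen_compl_singleton le_rfl).clm_apply continuousOn_const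

lemma ContDiffOn.pd (hf : ContDiffOn ℝ 2 f {0}ᶜ) (i : Fin N) :
    ContDiffOn ℝ 1 (pd f i) {0}ᶜ :=
  (hf.fderiv_of_isOpen isOpen_compl_singleton (by norm_num)).clm_apply contDiffOn_const

lemma pd_sqrt_sq (hf : DifferentiableAt ℝ f x) (hx : 0 < f x) (i : Fin N) :
    pd (fun y => Real.sqrt (f y)) i x ^ 2 = pd f i x ^ 2 / (4 * f x) := by
  rw [pd, (hf.hasFDerivAt.sqrt hx.ne').fderiv]
  simp only [FunLike.coe_smul, Pi.smul_apply, smul_eq_mul, mul_pow, div_pow, pd, one_pow,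
    Real.sq_sqrt hx.le]
  ring

lemma ContinuousOn.aestronglyMeasurable_of_compl_zero [NeZero N] (hf : ContinuousOn f {0}ᶜ) :
    AEStronglyMeasurable f := by
  have h := hf.aestronglyMeasurable (μ := volume) (measurableSet_singleton _).compl
  rwa [restrict_compl_singleton] at h

lemma ae_ne_zero [NeZero N] : ∀ᵐ x : EuclideanSpace ℝ (Fin N), x ≠ 0 :=
  Measure.ae_ne volume 0

end PartialDerivatives

/-! ### The cutoff functions -/

section Cutoff

variable {N : ℕ} {h : EuclideanSpace ℝ (Fin N) → ℝ}

lemma contDiff_cutoff (n : ℕ) : ContDiff ℝ 1 (cutoff (N := N) n) :=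
  Real.smoothTransition.contDiff.comp
    ((contDiff_const.mul (contDiff_id.norm_sq ℝ)).sub contDiff_const)

lemma cutoff_nonneg (n : ℕ) (x : EuclideanSpace ℝ (Fin N)) : 0 ≤ cutoff n x :=
  Real.smoothTransition.nonneg _

lemma cutoff_le_one (n : ℕ) (x : EuclideanSpace ℝ (Fin N)) : cutoff n x ≤ 1 :=
  Real.smoothTransition.le_one _

lemma zero_notMem_tsupport_cutoff (n : ℕ) :
    (0 : EuclideanSpace ℝ (Fin N)) ∉ tsupport (cutoff n) := by
  rw [notMem_tsupport_iff_eventuallyEq]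
  have hc : Continuous fun x : EuclideanSpace ℝ (Fin N) => (n : ℝ) ^ 2 * ‖x‖ ^ 2 - 1 := by
    fun_prop
  filter_upwards [hc.continuousAt.eventually_lt continuousAt_const (by simp :
    (n : ℝ) ^ 2 * ‖(0 : EuclideanSpace ℝ (Fin N))‖ ^ 2 - 1 < 0)] with x hx
  exact Real.smoothTransition.zero_of_nonpos hx.le

lemma tendsto_cutoff_argument {x : EuclideanSpace ℝ (Fin N)} (hx : x ≠ 0) :
    Tendsto (fun n : ℕ => (n : ℝ) ^ 2 * ‖x‖ ^ 2 - 1) atTop atTop := by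
  refine tendsto_atTop_add_const_right _ _ (Tendsto.atTop_mul_const (by positivity) ?_)
  exact (tendsto_pow_atTop two_ne_zero).comp tendsto_natCast_atTop_atTop

lemma eventually_cutoff_eq_one {x : EuclideanSpace ℝ (Fin N)} (hx : x ≠ 0) :
    ∀ᶠ n : ℕ in atTop, cutoff n x = 1 := by
  filter_upwards [(tendsto_cutoff_argument hx).eventually_ge_atTop 1] with n hn
  exact Real.smoothTransition.one_of_one_le hn

lemma pd_cutoff (n : ℕ) (i : Fin N) (x : EuclideanSpace ℝ (Fin N)) :
    pd (cutoff n) i x =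
      deriv Real.smoothTransition ((n : ℝ) ^ 2 * ‖x‖ ^ 2 - 1) * (2 * (n : ℝ) ^ 2 * x i) := by
  have h1 : HasFDerivAt (fun x : EuclideanSpace ℝ (Fin N) => (n : ℝ) ^ 2 * ‖x‖ ^ 2 - 1) _ x :=
    ((hasStrictFDerivAt_norm_sq x).hasFDerivAt.const_mul _).sub_const _
  have hS : HasDerivAt Real.smoothTransition _ ((n : ℝ) ^ 2 * ‖x‖ ^ 2 - 1) :=
    ((Real.smoothTransition.contDiff (n := 1)).differentiable (by simp)).differentiableAt.hasDerivAt
  have hc : HasFDerivAt (cutoff n) _ x := hS.comp_hasFDerivAt x h1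
  rw [pd, hc.fderiv]
  simp only [FunLike.coe_smul, Pi.smul_apply, coe_innerSL_apply, EuclideanSpace.inner_single_right]
  simp
  grind

/-- A continuous function that vanishes near the origin removes a singularity there. -/
lemma continuous_mul_of_zero_notMem_tsupport {a : EuclideanSpace ℝ (Fin N) → ℝ}
    (ha : Continuous a) (h0 : (0 : EuclideanSpace ℝ (Fin N)) ∉ tsupport a)
    (hh : ContinuousOn h {0}ᶜ) : Continuous fun x => a x * h x := by
  refine continuous_of_tsupport fun x hx => ?_
  have hx0 : x ≠ 0 := fun hx0 => h0 (hx0 ▸ tsupport_mul_subset_left hx)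
  exact ha.continuousAt.mul (hh.continuousAt (isOpen_compl_singleton.mem_nhds hx0))

lemma integrable_cutoff_mul (n : ℕ) (hh : ContinuousOn h {0}ᶜ) (hc : HasCompactSupport h) :
    Integrable fun x => cutoff n x * h x :=
  (continuous_mul_of_zero_notMem_tsupport (contDiff_cutoff n).continuous
    (zero_notMem_tsupport_cutoff n) hh).integrable_of_hasCompactSupport hc.mul_left

lemma integrable_pd_cutoff_mul (n : ℕ) (i : Fin N) (hh : ContinuousOn h {0}ᶜ)
    (hc : HasCompactSupport h) : Integrable fun x => pd (cutoff n) i x * h x :=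
  (continuous_mul_of_zero_notMem_tsupport
    (((contDiff_cutoff n).continuous_fderiv (by simp)).clm_apply continuous_const)
    (fun h0 => zero_notMem_tsupport_cutoff n (tsupport_fderiv_apply_subset ℝ _ h0))
    hh).integrable_of_hasCompactSupport hc.mul_left

/-- The divergence theorem for a cut-off vector field that may be singular at the origin. -/
lemma integral_cutoff_mul_divergence (n : ℕ) {G : Fin N → EuclideanSpace ℝ (Fin N) → ℝ}
    (hG : ∀ i, ContDiffOn ℝ 1 (G i) {0}ᶜ) (hc : ∀ i, HasCompactSupport (G i)) :
    ∫ x, cutoff n x * ∑ i, pd (G i) i x = -∫ x, ∑ i, pd (cutoff n) i x * G i x := by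
  have hint i : Integrable fun x => cutoff n x * pd (G i) i x :=
    integrable_cutoff_mul n ((hG i).continuousOn_pd i) ((hc i).fderiv_apply ℝ _)
  have hint' i : Integrable fun x => pd (cutoff n) i x * G i x :=
    integrable_pd_cutoff_mul n i (hG i).continuousOn (hc i)
  simp only [Finset.mul_sum]
  rw [integral_finsetSum _ fun i _ => hint i, integral_finsetSum _ fun i _ => hint' i,
    ← Finset.sum_neg_distrib]
  refine Finset.sum_congr rfl fun i _ => ?_
  refine integral_mul_fderiv_eq_neg_fderiv_mul_of_integrable (hint' i) (hint i)
    (integrable_cutoff_mul n (hG i).continuousOn (hc i))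
    (fun x _ => (contDiff_cutoff n).differentiable (by simp) x) fun x hx => ?_
  exact (hG i).differentiableAt_of_ne_zero fun hx0 => zero_notMem_tsupport_cutoff n (hx0 ▸ hx)

lemma exists_bound_deriv_smoothTransition :
    ∃ C, ∀ t, |deriv Real.smoothTransition t * (t + 1)| ≤ C := by
  have hcont : Continuous fun t => deriv Real.smoothTransition t * (t + 1) :=
    ((Real.smoothTransition.contDiff (n := 1)).continuous_deriv (by simp)).mul (by fun_prop)
  have hzero : ∀ t ∉ Icc (0 : ℝ) 1, deriv Real.smoothTransition t = 0 := by
    intro t ht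
    rcases lt_or_ge t 0 with h | h
    · have : Real.smoothTransition =ᶠ[𝓝 t] fun _ => 0 := by
        filter_upwards [Iio_mem_nhds h] with s hs
        exact Real.smoothTransition.zero_of_nonpos (le_of_lt hs)
      simp [this.deriv_eq]
    · have h1 : 1 < t := by
        by_contra hle
        exact ht ⟨h, not_lt.mp hle⟩
      have : Real.smoothTransition =ᶠ[𝓝 t] fun _ => 1 := by
        filter_upwards [Ioi_mem_nhds h1] with s hs
        exact Real.smoothTransition.one_of_one_le (le_of_lt hs)
      simp [this.deriv_eq]
  obtain ⟨C, hC⟩ := hcont.bounded_above_of_compact_support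
    (HasCompactSupport.intro (isCompact_Icc (a := (0 : ℝ)) (b := 1)) fun t ht => by simp [hzero t ht])
  exact ⟨C, hC⟩

lemma eventually_pd_cutoff_eq_zero {x : EuclideanSpace ℝ (Fin N)} (hx : x ≠ 0) :
    ∀ᶠ n : ℕ in atTop, ∀ i, pd (cutoff n) i x = 0 := by
  filter_upwards [(tendsto_cutoff_argument hx).eventually_gt_atTop 1] with n hn i
  have : Real.smoothTransition =ᶠ[𝓝 ((n : ℝ) ^ 2 * ‖x‖ ^ 2 - 1)] fun _ => 1 := by
    filter_upwards [Ioi_mem_nhds hn] with s hs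
    exact Real.smoothTransition.one_of_one_le (le_of_lt hs)
  simp [pd_cutoff, this.deriv_eq]

/-- The cutoff functions satisfy `|∂ᵢ ηₙ| ≤ C / ‖x‖` uniformly in `n`. -/
lemma exists_bound_pd_cutoff :
    ∃ C, ∀ (n : ℕ) (i : Fin N) (x : EuclideanSpace ℝ (Fin N)), x ≠ 0 →
      |pd (cutoff n) i x| ≤ C / ‖x‖ := by
  obtain ⟨C, hC⟩ := exists_bound_deriv_smoothTransition
  refine ⟨2 * C, fun n i x hx => ?_⟩
  have hr : 0 < ‖x‖ := norm_pos_iff.mpr hx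
  have hxi : |x i| ≤ ‖x‖ := by simpa using PiLp.norm_apply_le x i
  have h := hC ((n : ℝ) ^ 2 * ‖x‖ ^ 2 - 1)
  rw [pd_cutoff, le_div_iff₀ hr]
  rw [sub_add_cancel, abs_mul, abs_of_nonneg (by positivity : 0 ≤ (n : ℝ) ^ 2 * ‖x‖ ^ 2)] at h
  rw [abs_mul, abs_mul, abs_of_nonneg (by positivity : 0 ≤ 2 * (n : ℝ) ^ 2)]
  calc _ ≤ |deriv Real.smoothTransition ((n : ℝ) ^ 2 * ‖x‖ ^ 2 - 1)| *
        (2 * (n : ℝ) ^ 2 * ‖x‖) * ‖x‖ := by gcongr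
    _ = 2 * (|deriv Real.smoothTransition ((n : ℝ) ^ 2 * ‖x‖ ^ 2 - 1)| *
        ((n : ℝ) ^ 2 * ‖x‖ ^ 2)) := by ring
    _ ≤ 2 * C := by gcongr

end Cutoff

/-! ### The Hardy inequality -/

section Hardy

variable {N : ℕ} {μ φ : EuclideanSpace ℝ (Fin N) → ℝ}

lemma pd_radial_field {x : EuclideanSpace ℝ (Fin N)} (hx : x ≠ 0) (hφ : DifferentiableAt ℝ φ x)
    (hμ : DifferentiableAt ℝ μ x) (i : Fin N) :
    pd (fun y => φ y ^ 2 * μ y * (y i / ‖y‖ ^ 2)) i x =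
      φ x ^ 2 * μ x * (1 / ‖x‖ ^ 2 - 2 * x i ^ 2 / (‖x‖ ^ 2) ^ 2) +
        x i / ‖x‖ ^ 2 * (φ x ^ 2 * pd μ i x + μ x * (2 * φ x * pd φ i x)) := by
  have hr : ‖x‖ ^ 2 ≠ 0 := by positivity
  have hd : DifferentiableAt ℝ (fun y : EuclideanSpace ℝ (Fin N) => y i / ‖y‖ ^ 2) x := by
    have h1 : DifferentiableAt ℝ (fun y : EuclideanSpace ℝ (Fin N) => y i) x := by fun_prop
    have h2 := (hasStrictFDerivAt_norm_sq x).hasFDerivAt.differentiableAt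
    simpa only [div_eq_mul_inv] using h1.fun_mul (h2.fun_inv hr)
  rw [pd_mul ((hφ.fun_pow 2).fun_mul hμ) hd, pd_coord_div_norm_sq hx, pd_mul (hφ.fun_pow 2) hμ,
    pd_sq hφ]

lemma energyDensity_nonneg {x : EuclideanSpace ℝ (Fin N)} (hμx : 0 < μ x) :
    0 ≤ energyDensity μ φ x := by
  refine Finset.sum_nonneg fun i _ => ?_
  have : pd φ i x ^ 2 * μ x + φ x * pd φ i x * pd μ i x + φ x ^ 2 * (pd μ i x ^ 2 / (4 * μ x)) =
      μ x * (pd φ i x + φ x * pd μ i x / (2 * μ x)) ^ 2 := by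
    field_simp
    ring
  rw [this]
  positivity

/-- Completing the square in the Hardy inequality. -/
lemma hardy_pointwise {x : EuclideanSpace ℝ (Fin N)} (hx : x ≠ 0) (hφ : DifferentiableAt ℝ φ x)
    (hμ : DifferentiableAt ℝ μ x) (hμx : 0 < μ x) :
    ((N - 2 : ℝ) / 2) ^ 2 * (φ x ^ 2 / ‖x‖ ^ 2 * μ x) ≤ energyDensity μ φ x +
      (N - 2 : ℝ) / 2 * ∑ i, pd (fun y => φ y ^ 2 * μ y * (y i / ‖y‖ ^ 2)) i x := by
  set c : ℝ := (N - 2 : ℝ) / 2 with hc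
  have hN : (N : ℝ) = 2 * c + 2 := by rw [hc]; ring
  have hsum : ∑ i, x i ^ 2 = ‖x‖ ^ 2 := (EuclideanSpace.real_norm_sq_eq x).symm
  have hr : 0 < ‖x‖ ^ 2 := by positivity
  have hsq : 0 ≤ ∑ i, μ x *
      (pd φ i x + φ x * pd μ i x / (2 * μ x) + c * φ x * x i / ‖x‖ ^ 2) ^ 2 :=
    Finset.sum_nonneg fun i _ => by positivity
  simp only [pd_radial_field hx hφ hμ]
  generalize ‖x‖ ^ 2 = r at *
  have hterm : ∀ i, μ x * (pd φ i x + φ x * pd μ i x / (2 * μ x) + c * φ x * x i / r) ^ 2 =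
      (pd φ i x ^ 2 * μ x + φ x * pd φ i x * pd μ i x + φ x ^ 2 * (pd μ i x ^ 2 / (4 * μ x))) +
      c * (φ x ^ 2 * μ x * (1 / r - 2 * x i ^ 2 / r ^ 2) +
        x i / r * (φ x ^ 2 * pd μ i x + μ x * (2 * φ x * pd φ i x))) +
      ((c ^ 2 + 2 * c) * φ x ^ 2 * μ x / r ^ 2 * x i ^ 2 - c * φ x ^ 2 * μ x / r) := by
    intro i
    field_simp
    ring
  simp only [hterm, Finset.sum_add_distrib, Finset.sum_sub_distrib, ← Finset.mul_sum, hsum] at hsq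
  simp only [energyDensity, Finset.sum_add_distrib, Finset.sum_sub_distrib, ← Finset.mul_sum]
  have hconst : ∑ _i : Fin N, c * φ x ^ 2 * μ x / r = (2 * c + 2) * (c * φ x ^ 2 * μ x / r) := by
    simp [hN]
  rw [hconst] at hsq
  have : (c ^ 2 + 2 * c) * φ x ^ 2 * μ x / r ^ 2 * r - (2 * c + 2) * (c * φ x ^ 2 * μ x / r) =
      -(c ^ 2 * (φ x ^ 2 / r * μ x)) := by
    field_simp
    ring
  linarith

lemma HasCompactSupport.sq_left (hφc : HasCompactSupport φ) :
    HasCompactSupport fun x => φ x ^ 2 :=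
  hφc.comp_left (g := fun t : ℝ => t ^ 2) (by simp)

lemma integrable_cutoff_mul_hardy (n : ℕ) (hμ : ContDiffOn ℝ 1 μ {0}ᶜ) (hφ : ContDiff ℝ 1 φ)
    (hφc : HasCompactSupport φ) :
    Integrable fun x => cutoff n x * (φ x ^ 2 / ‖x‖ ^ 2 * μ x) := by
  refine integrable_cutoff_mul n (ContinuousOn.mul (ContinuousOn.div
    (hφ.continuous.pow 2).continuousOn (by fun_prop) fun x hx =>
      pow_ne_zero 2 (norm_ne_zero_iff.mpr hx)) hμ.continuousOn) ?_
  simp only [div_eq_mul_inv]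
  exact hφc.sq_left.mul_right.mul_right

lemma hardy_cutoff [NeZero N]
    (hμpos : ∀ x : EuclideanSpace ℝ (Fin N), x ≠ 0 → 0 < μ x)
    (hμC2 : ContDiffOn ℝ 2 μ {(0 : EuclideanSpace ℝ (Fin N))}ᶜ)
    (hφ : ContDiff ℝ 1 φ) (hφc : HasCompactSupport φ)
    (hN : 2 ≤ N) (hD : Integrable (energyDensity μ φ)) (n : ℕ) :
    ((N - 2 : ℝ) / 2) ^ 2 * ∫ x, cutoff n x * (φ x ^ 2 / ‖x‖ ^ 2 * μ x) ≤
      ∫ x, energyDensity μ φ x := by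
  have hc : 0 ≤ (N - 2 : ℝ) / 2 := by
    have : (2 : ℝ) ≤ N := by exact_mod_cast hN
    linarith
  have hμ1 : ContDiffOn ℝ 1 μ {0}ᶜ := hμC2.of_le (by norm_num)
  set G : Fin N → EuclideanSpace ℝ (Fin N) → ℝ := fun i y => φ y ^ 2 * μ y * (y i / ‖y‖ ^ 2)
  have hG : ∀ i, ContDiffOn ℝ 1 (G i) {0}ᶜ := fun i =>
    ((hφ.contDiffOn.pow 2).mul hμ1).mul
      (ContDiffOn.div (by fun_prop) (contDiff_id.norm_sq ℝ).contDiffOn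
        fun x hx => pow_ne_zero 2 (norm_ne_zero_iff.mpr hx))
  have hGc : ∀ i, HasCompactSupport (G i) := fun i => hφc.sq_left.mul_right.mul_right
  have hdiv : ∫ x, cutoff n x * ∑ i, pd (G i) i x ≤ 0 := by
    rw [integral_cutoff_mul_divergence n hG hGc, neg_nonpos]
    refine integral_nonneg_of_ae ?_
    filter_upwards [ae_ne_zero] with x hx
    refine Finset.sum_nonneg fun i _ => ?_
    have hS : 0 ≤ deriv Real.smoothTransition ((n : ℝ) ^ 2 * ‖x‖ ^ 2 - 1) :=
      Real.smoothTransition.monotone.deriv_nonneg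
    have hμx := hμpos x hx
    have : pd (cutoff n) i x * G i x =
        deriv Real.smoothTransition ((n : ℝ) ^ 2 * ‖x‖ ^ 2 - 1) * (2 * (n : ℝ) ^ 2) *
          (φ x ^ 2 * μ x * (x i ^ 2 / ‖x‖ ^ 2)) := by
      rw [pd_cutoff]
      ring
    rw [this]
    positivity
  have hdivint : Integrable fun x => cutoff n x * ∑ i, pd (G i) i x := by
    simp only [Finset.mul_sum]
    exact integrable_finsetSum _ fun i _ =>
      integrable_cutoff_mul n ((hG i).continuousOn_pd i) ((hGc i).fderiv_apply ℝ _)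
  have hp : Integrable fun x => cutoff n x * (φ x ^ 2 / ‖x‖ ^ 2 * μ x) :=
    integrable_cutoff_mul_hardy n hμ1 hφ hφc
  rw [← integral_const_mul]
  calc _ ≤ ∫ x, (energyDensity μ φ x + (N - 2 : ℝ) / 2 * (cutoff n x * ∑ i, pd (G i) i x)) := by
        refine integral_mono_ae (hp.const_mul _) (hD.add (hdivint.const_mul _)) ?_
        filter_upwards [ae_ne_zero] with x hx
        have h := mul_le_mul_of_nonneg_left (hardy_pointwise hx
          (hφ.differentiable (by simp) x) (hμ1.differentiableAt_of_ne_zero hx) (hμpos x hx))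
          (cutoff_nonneg n x)
        have h' := mul_le_mul_of_nonneg_right (cutoff_le_one n x)
          (energyDensity_nonneg (φ := φ) (hμpos x hx))
        simp only [G]
        linarith
    _ = (∫ x, energyDensity μ φ x) +
          (N - 2 : ℝ) / 2 * ∫ x, cutoff n x * ∑ i, pd (G i) i x := by
        rw [integral_add hD (hdivint.const_mul _), integral_const_mul]
    _ ≤ _ := by
        have := mul_nonpos_of_nonneg_of_nonpos hc hdiv
        linarith

/-- The Hardy inequality for `φ √μ`, together with the integrability of the left-hand side. -/
lemma hardy_energyDensity [NeZero N]
    (hμpos : ∀ x : EuclideanSpace ℝ (Fin N), x ≠ 0 → 0 < μ x)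
    (hμC2 : ContDiffOn ℝ 2 μ {(0 : EuclideanSpace ℝ (Fin N))}ᶜ)
    (hφ : ContDiff ℝ 1 φ) (hφc : HasCompactSupport φ)
    (hN : 3 ≤ N) (hD : Integrable (energyDensity μ φ)) :
    Integrable (fun x => φ x ^ 2 / ‖x‖ ^ 2 * μ x) ∧
      ((N - 2 : ℝ) / 2) ^ 2 * ∫ x, φ x ^ 2 / ‖x‖ ^ 2 * μ x ≤ ∫ x, energyDensity μ φ x := by
  have hc : 0 < ((N - 2 : ℝ) / 2) ^ 2 := by
    have : (3 : ℝ) ≤ N := by exact_mod_cast hN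
    have : 0 < (N - 2 : ℝ) / 2 := by linarith
    positivity
  have hμ1 : ContDiffOn ℝ 1 μ {0}ᶜ := hμC2.of_le (by norm_num)
  set p : EuclideanSpace ℝ (Fin N) → ℝ := fun x => φ x ^ 2 / ‖x‖ ^ 2 * μ x
  have hpn : ∀ᵐ x, 0 ≤ p x := by
    filter_upwards [ae_ne_zero] with x hx
    have := hμpos x hx
    positivity
  have hpint : ∀ n, Integrable fun x => cutoff n x * p x := fun n =>
    integrable_cutoff_mul_hardy n hμ1 hφ hφc
  set A : ℕ → Set (EuclideanSpace ℝ (Fin N)) := fun n => {x | 1 ≤ (n : ℝ) ^ 2 * ‖x‖ ^ 2 - 1}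
  have hAm : ∀ n, MeasurableSet (A n) := fun n =>
    measurableSet_le measurable_const (by fun_prop)
  have hA : AECover volume atTop A := by
    refine ⟨?_, hAm⟩
    filter_upwards [ae_ne_zero] with x hx
    exact (tendsto_cutoff_argument hx).eventually_ge_atTop 1
  have heq : ∀ n, ∀ x ∈ A n, cutoff n x * p x = p x := fun n x hx => by
    rw [cutoff, Real.smoothTransition.one_of_one_le hx, one_mul]
  have hon : ∀ n, IntegrableOn p (A n) := fun n =>
    (hpint n).integrableOn.congr_fun (heq n) (hAm n)
  have hle : ∀ n, ∫ x in A n, p x ≤ (∫ x, energyDensity μ φ x) / ((N - 2 : ℝ) / 2) ^ 2 := by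
    intro n
    rw [← setIntegral_congr_fun (hAm n) (heq n), le_div_iff₀' hc]
    refine le_trans ?_ (hardy_cutoff hμpos hμC2 hφ hφc (by omega) hD n)
    refine mul_le_mul_of_nonneg_left (setIntegral_le_integral (hpint n) ?_) hc.le
    filter_upwards [hpn] with x hx
    exact mul_nonneg (cutoff_nonneg n x) hx
  have hint : Integrable p :=
    hA.integrable_of_integral_bounded_of_nonneg_ae _ hon hpn (Eventually.of_forall hle)
  refine ⟨hint, ?_⟩
  rw [← le_div_iff₀' hc]
  exact le_of_tendsto' (hA.integral_tendsto_of_countably_generated hint) hle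

/-- The vector field `φ² ∇μ` has no flux through the origin. -/
lemma integral_divergence_eq_zero [NeZero N]
    (hμpos : ∀ x : EuclideanSpace ℝ (Fin N), x ≠ 0 → 0 < μ x)
    (hμC2 : ContDiffOn ℝ 2 μ {(0 : EuclideanSpace ℝ (Fin N))}ᶜ)
    (hφ : ContDiff ℝ 1 φ) (hφc : HasCompactSupport φ)
    (hp : Integrable fun x => φ x ^ 2 / ‖x‖ ^ 2 * μ x)
    (hg : ∀ i, Integrable fun x => φ x ^ 2 * (pd μ i x ^ 2 / (4 * μ x)))
    (hdiv : Integrable fun x => ∑ i, pd (fun y => φ y ^ 2 * pd μ i y) i x) :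
    ∫ x, ∑ i, pd (fun y => φ y ^ 2 * pd μ i y) i x = 0 := by
  set G : Fin N → EuclideanSpace ℝ (Fin N) → ℝ := fun i y => φ y ^ 2 * pd μ i y with hGdef
  have hG : ∀ i, ContDiffOn ℝ 1 (G i) {0}ᶜ := fun i => (hφ.contDiffOn.pow 2).mul (hμC2.pd i)
  have hGc : ∀ i, HasCompactSupport (G i) := fun i => hφc.sq_left.mul_right
  obtain ⟨C, hC⟩ := exists_bound_pd_cutoff (N := N)
  have h1 : Tendsto (fun n : ℕ => ∫ x, cutoff n x * ∑ i, pd (G i) i x) atTop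
      (𝓝 (∫ x, ∑ i, pd (G i) i x)) := by
    refine tendsto_integral_of_dominated_convergence (fun x => ‖∑ i, pd (G i) i x‖) (fun n => ?_)
      hdiv.norm (fun n => ?_) ?_
    · exact (contDiff_cutoff n).continuous.aestronglyMeasurable.mul hdiv.aestronglyMeasurable
    · refine Eventually.of_forall fun x => ?_
      rw [norm_mul, Real.norm_of_nonneg (cutoff_nonneg n x)]
      exact mul_le_of_le_one_left (norm_nonneg _) (cutoff_le_one n x)
    · filter_upwards [ae_ne_zero] with x hx
      refine tendsto_const_nhds.congr' ?_
      filter_upwards [eventually_cutoff_eq_one hx] with n hn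
      rw [hn, one_mul]
  have h2 : Tendsto (fun n : ℕ => ∫ x, ∑ i, pd (cutoff n) i x * G i x) atTop
      (𝓝 (∫ _ : EuclideanSpace ℝ (Fin N), (0 : ℝ))) := by
    refine tendsto_integral_of_dominated_convergence
      (fun x => ∑ i, |C| * (φ x ^ 2 * (pd μ i x ^ 2 / (4 * μ x)) + φ x ^ 2 / ‖x‖ ^ 2 * μ x))
      (fun n => ?_) (integrable_finsetSum _ fun i _ => ((hg i).add hp).const_mul _)
      (fun n => ?_) ?_
    · exact (integrable_finsetSum _ fun i _ => integrable_pd_cutoff_mul n i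
        (hG i).continuousOn (hGc i)).aestronglyMeasurable
    · filter_upwards [ae_ne_zero] with x hx
      refine (norm_sum_le _ _).trans (Finset.sum_le_sum fun i _ => ?_)
      have hμx := hμpos x hx
      have hr : 0 < ‖x‖ := norm_pos_iff.mpr hx
      have hCx : |pd (cutoff n) i x| ≤ |C| / ‖x‖ :=
        (hC n i x hx).trans (by gcongr; exact le_abs_self C)
      have hamgm : |pd μ i x| / ‖x‖ ≤ pd μ i x ^ 2 / (4 * μ x) + μ x / ‖x‖ ^ 2 := by
        have : 0 ≤ μ x * (|pd μ i x| / (2 * μ x) - 1 / ‖x‖) ^ 2 := by positivity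
        have heq : μ x * (|pd μ i x| / (2 * μ x) - 1 / ‖x‖) ^ 2 =
            |pd μ i x| ^ 2 / (4 * μ x) + μ x / ‖x‖ ^ 2 - |pd μ i x| / ‖x‖ := by
          field_simp
          ring
        rw [heq, sq_abs] at this
        linarith
      calc ‖pd (cutoff n) i x * G i x‖ = |pd (cutoff n) i x| * (φ x ^ 2 * |pd μ i x|) := by
            rw [Real.norm_eq_abs, hGdef, abs_mul, abs_mul, abs_sq]
        _ ≤ |C| / ‖x‖ * (φ x ^ 2 * |pd μ i x|) := by gcongr
        _ = |C| * (φ x ^ 2 * (|pd μ i x| / ‖x‖)) := by ring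
        _ ≤ |C| * (φ x ^ 2 * (pd μ i x ^ 2 / (4 * μ x) + μ x / ‖x‖ ^ 2)) := by gcongr
        _ = _ := by ring
    · filter_upwards [ae_ne_zero] with x hx
      refine tendsto_const_nhds.congr' ?_
      filter_upwards [eventually_pd_cutoff_eq_zero hx] with n hn
      simp [hn]
  simp only [integral_cutoff_mul_divergence _ hG hGc] at h1
  simpa using tendsto_nhds_unique h1 h2.neg

end Hardy

/-- Weighted Hardy inequality with the potential `U_μ`:
`c₀(N) ∫ φ²/|x|² dμ ≤ ∫ |∇φ|² dμ + ∫ U_μ φ² dμ`. -/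
theorem weighted_hardy_with_potential (N : ℕ) (hN : 3 ≤ N)
    (μ φ : EuclideanSpace ℝ (Fin N) → ℝ)
    (hμpos : ∀ x : EuclideanSpace ℝ (Fin N), x ≠ 0 → 0 < μ x)
    (hμC2 : ContDiffOn ℝ 2 μ {(0 : EuclideanSpace ℝ (Fin N))}ᶜ)
    (hsqrtL2loc : ∀ K : Set (EuclideanSpace ℝ (Fin N)), IsCompact K →
      IntegrableOn (fun x => Real.sqrt (μ x) ^ 2) K)
    (hgradL2loc : ∀ K : Set (EuclideanSpace ℝ (Fin N)), IsCompact K →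
      IntegrableOn (fun x => ‖gradient (fun y => Real.sqrt (μ y)) x‖ ^ 2) K)
    (hΔL1loc : ∀ K : Set (EuclideanSpace ℝ (Fin N)), IsCompact K →
      IntegrableOn (fun x => lap μ x) K)
    (hφ : ContDiff ℝ (⊤ : ℕ∞) φ) (hφc : HasCompactSupport φ) :
    ((N - 2 : ℝ) / 2) ^ 2 * ∫ x, φ x ^ 2 / ‖x‖ ^ 2 * μ x ≤
      (∫ x, ‖gradient φ x‖ ^ 2 * μ x) + ∫ x, Umu μ x * φ x ^ 2 * μ x := by
  have : NeZero N := ⟨by omega⟩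
  have hφ1 : ContDiff ℝ 1 φ := hφ.of_le (by exact_mod_cast le_top)
  have hμ1 : ContDiffOn ℝ 1 μ {0}ᶜ := hμC2.of_le (by norm_num)
  have hφpd : ∀ i, Continuous (pd φ i) := fun i =>
    (hφ1.continuous_fderiv (by simp)).clm_apply continuous_const
  have hφsq := hφc.sq_left
  have hgradφ : ∀ i, Integrable fun x => pd φ i x ^ 2 * μ x := by
    intro i
    have hc : HasCompactSupport fun x => pd φ i x ^ 2 := (hφc.fderiv_apply ℝ _).sq_left
    refine ((locallyIntegrable_iff.mpr hsqrtL2loc).integrable_smul_left_of_hasCompactSupport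
      ((hφpd i).pow 2) hc).congr ?_
    filter_upwards [ae_ne_zero] with x hx
    rw [smul_eq_mul, Real.sq_sqrt (hμpos x hx).le, Pi.pow_apply]
  have hgradμsum : Integrable fun x => φ x ^ 2 * ∑ i, pd μ i x ^ 2 / (4 * μ x) := by
    refine ((locallyIntegrable_iff.mpr hgradL2loc).integrable_smul_left_of_hasCompactSupport
      (hφ1.continuous.pow 2) hφsq).congr ?_
    filter_upwards [ae_ne_zero] with x hx
    simp only [smul_eq_mul, norm_gradient_sq,
      pd_sqrt_sq (hμ1.differentiableAt_of_ne_zero hx) (hμpos x hx), Pi.pow_apply]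
  have hgradμ : ∀ i, Integrable fun x => φ x ^ 2 * (pd μ i x ^ 2 / (4 * μ x)) := by
    intro i
    refine hgradμsum.mono' (ContinuousOn.aestronglyMeasurable_of_compl_zero ?_) ?_
    · exact (hφ1.continuous.pow 2).continuousOn.mul (((hμ1.continuousOn_pd i).pow 2).div
        (continuousOn_const.mul hμ1.continuousOn) fun x hx => (mul_pos four_pos (hμpos x hx)).ne')
    · filter_upwards [ae_ne_zero] with x hx
      have hμx := hμpos x hx
      rw [Real.norm_of_nonneg (by positivity)]
      gcongr
      exact Finset.single_le_sum (f := fun i => pd μ i x ^ 2 / (4 * μ x))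
        (fun j _ => by positivity) (Finset.mem_univ i)
  have hcross : ∀ i, Integrable fun x => φ x * pd φ i x * pd μ i x := by
    intro i
    refine ((hgradφ i).add (hgradμ i)).mono'
      (ContinuousOn.aestronglyMeasurable_of_compl_zero ?_) ?_
    · exact (hφ1.continuous.mul (hφpd i)).continuousOn.mul (hμ1.continuousOn_pd i)
    · filter_upwards [ae_ne_zero] with x hx
      have hμx := hμpos x hx
      have h1 : 0 ≤ μ x * (pd φ i x + φ x * pd μ i x / (2 * μ x)) ^ 2 := by positivity
      have h2 : 0 ≤ μ x * (pd φ i x - φ x * pd μ i x / (2 * μ x)) ^ 2 := by positivity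
      have e1 : μ x * (pd φ i x + φ x * pd μ i x / (2 * μ x)) ^ 2 = pd φ i x ^ 2 * μ x +
          φ x ^ 2 * (pd μ i x ^ 2 / (4 * μ x)) + φ x * pd φ i x * pd μ i x := by
        field_simp
        ring
      have e2 : μ x * (pd φ i x - φ x * pd μ i x / (2 * μ x)) ^ 2 = pd φ i x ^ 2 * μ x +
          φ x ^ 2 * (pd μ i x ^ 2 / (4 * μ x)) - φ x * pd φ i x * pd μ i x := by
        field_simp
        ring
      rw [Real.norm_eq_abs, abs_le, Pi.add_apply]
      constructor <;> linarith
  have hlap : Integrable fun x => φ x ^ 2 * lap μ x :=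
    (locallyIntegrable_iff.mpr hΔL1loc).integrable_smul_left_of_hasCompactSupport
      (hφ1.continuous.pow 2) hφsq
  have hD : Integrable (energyDensity μ φ) :=
    integrable_finsetSum _ fun i _ => ((hgradφ i).add (hcross i)).add (hgradμ i)
  obtain ⟨hp, hle⟩ := hardy_energyDensity hμpos hμC2 hφ1 hφc hN hD
  have hdiveq : ∀ x ≠ 0, ∑ i, pd (fun y => φ y ^ 2 * pd μ i y) i x =
      φ x ^ 2 * lap μ x + 2 * ∑ i, φ x * pd φ i x * pd μ i x := by
    intro x hx
    have hφx : DifferentiableAt ℝ φ x := hφ1.differentiable (by simp) x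
    have hlap' : lap μ x = ∑ i, pd (pd μ i) i x := rfl
    rw [hlap', Finset.mul_sum, Finset.mul_sum, ← Finset.sum_add_distrib]
    refine Finset.sum_congr rfl fun i _ => ?_
    rw [pd_mul (hφx.fun_pow 2) ((hμC2.pd i).differentiableAt_of_ne_zero hx), pd_sq hφx]
    ring
  have hdiv : Integrable fun x => ∑ i, pd (fun y => φ y ^ 2 * pd μ i y) i x := by
    refine (hlap.add ((integrable_finsetSum Finset.univ fun i _ => hcross i).const_mul 2)).congr ?_
    filter_upwards [ae_ne_zero] with x hx
    exact (hdiveq x hx).symm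
  have hzero := integral_divergence_eq_zero hμpos hμC2 hφ1 hφc hp hgradμ hdiv
  have hgradint : Integrable fun x => ‖gradient φ x‖ ^ 2 * μ x := by
    simp only [norm_gradient_sq, Finset.sum_mul]
    exact integrable_finsetSum _ fun i _ => hgradφ i
  have hUeq : ∀ x ≠ 0, Umu μ x * φ x ^ 2 * μ x =
      φ x ^ 2 * ∑ i, pd μ i x ^ 2 / (4 * μ x) - 1 / 2 * (φ x ^ 2 * lap μ x) := by
    intro x hx
    have hμx := hμpos x hx
    rw [Umu, norm_gradient_sq, ← Finset.sum_div]
    field_simp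
  have hU : Integrable fun x => Umu μ x * φ x ^ 2 * μ x := by
    refine (hgradμsum.sub (hlap.const_mul (1 / 2))).congr ?_
    filter_upwards [ae_ne_zero] with x hx
    exact (hUeq x hx).symm
  refine hle.trans_eq ?_
  rw [← integral_add hgradint hU, ← add_zero (∫ x, (_ + _)), ← mul_zero (1 / 2 : ℝ), ← hzero,
    ← integral_const_mul, ← integral_add (hgradint.fun_add hU) (hdiv.const_mul _)]
  refine integral_congr_ae ?_
  filter_upwards [ae_ne_zero] with x hx
  simp only [hUeq x hx, hdiveq x hx, norm_gradient_sq, energyDensity,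
    Finset.sum_add_distrib, ← Finset.mul_sum, ← Finset.sum_mul]
  ring
end
end

section
/- Let N ≥ 3, R_0 ∈ (0,1], and let U : ℝ^N → ℝ satisfy U(x) ≤ 1/(4|x|^2 (log|x|)^2) for x ∈ B_{R_0}. Then for every u ∈ C_c^∞(B_{R_0}), ∫_{B_{R_0}} U u^2 dx ≤ ∫_{B_{R_0}} |∇u|^2 dx - c_0(N) ∫_{B_{R_0}} u^2/|x|^2 dx. -/
open MeasureTheory Metric Filter Set

noncomputable section

open scoped Topology ENNReal

/-- Euler's identity in integrated form: the divergence theorem for the field `φ(x) x`. -/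
lemma integral_fderiv_apply_self {N : ℕ} {φ : EuclideanSpace ℝ (Fin N) → ℝ}
    (hφ : ContDiff ℝ 1 φ) (hc : HasCompactSupport φ) :
    ∫ x, fderiv ℝ φ x x = -(N * ∫ x, φ x) := by
  have hdφ : Continuous (fderiv ℝ φ) := hφ.continuous_fderiv one_ne_zero
  let b := EuclideanSpace.basisFun (Fin N) ℝ
  have hint (i : Fin N) : Integrable (fun x => fderiv ℝ φ x (b i) * x i) :=
    Continuous.integrable_of_hasCompactSupport (by fun_prop)
      ((hc.fderiv_apply (𝕜 := ℝ) (b i)).mul_right)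
  have hcoord (i : Fin N) (x : EuclideanSpace ℝ (Fin N)) :
      fderiv ℝ (fun y : EuclideanSpace ℝ (Fin N) => y i) x (b i) = 1 := by
    have h : HasFDerivAt (fun y : EuclideanSpace ℝ (Fin N) => y i)
        (EuclideanSpace.proj i : EuclideanSpace ℝ (Fin N) →L[ℝ] ℝ) x :=
      (EuclideanSpace.proj i : EuclideanSpace ℝ (Fin N) →L[ℝ] ℝ).hasFDerivAt
    rw [h.fderiv]
    simp [b]
  have hparts (i : Fin N) : ∫ x, fderiv ℝ φ x (b i) * x i = -∫ x, φ x := by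
    have h := integral_mul_fderiv_eq_neg_fderiv_mul_of_integrable (μ := volume) (f := φ)
      (g := fun y : EuclideanSpace ℝ (Fin N) => y i) (v := b i) (hint i)
      (by simpa only [hcoord, mul_one] using
        hφ.continuous.integrable_of_hasCompactSupport hc)
      (Continuous.integrable_of_hasCompactSupport (by fun_prop) hc.mul_right)
      (fun x _ => (hφ.differentiable one_ne_zero) x) (fun x _ => by fun_prop)
    simp only [hcoord, mul_one] at h
    linarith
  have hsum (x : EuclideanSpace ℝ (Fin N)) :
      fderiv ℝ φ x x = ∑ i, fderiv ℝ φ x (b i) * x i := by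
    have h := congrArg (fderiv ℝ φ x) (b.sum_repr x)
    rw [← h, map_sum]
    exact Finset.sum_congr rfl fun i _ => by simp [b, mul_comm]
  simp_rw [hsum]
  rw [integral_finsetSum _ fun i _ => hint i]
  simp [hparts]

lemma hasDerivAt_hardyField (a : ℝ) {s : ℝ} (hs : 0 < s) (hs1 : s < 1) :
    HasDerivAt (fun s => (a - (Real.log s)⁻¹) / s)
      (((Real.log s)⁻¹ ^ 2 + (Real.log s)⁻¹ - a) / s ^ 2) s := by
  have hL : Real.log s ≠ 0 := (Real.log_neg hs hs1).ne
  refine ((((Real.hasDerivAt_log hs.ne').inv hL).const_sub a).div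
    (hasDerivAt_id' s) hs.ne').congr_deriv ?_
  simp only [Pi.inv_apply]
  field_simp
  ring

lemma hardy_potential_le {a r s l : ℝ} (ha : 0 ≤ a) (hs : 0 < s) (hrs : r ≤ s) (hl : l ≤ 0) :
    a ^ 2 / s + r * l ^ 2 / s ^ 2 ≤
      2 * r * ((l ^ 2 + l - a) / s ^ 2) + (2 * a + 2) * ((a - l) / s) - ((a - l) / s) ^ 2 * r := by
  have h : 2 * r * ((l ^ 2 + l - a) / s ^ 2) + (2 * a + 2) * ((a - l) / s)
      - ((a - l) / s) ^ 2 * r - (a ^ 2 / s + r * l ^ 2 / s ^ 2)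
      = (s - r) * (a ^ 2 + 2 * a * (-l) + 2 * a + 2 * (-l)) / s ^ 2 := by
    field_simp
    ring
  have h1 : 0 ≤ s - r := by linarith
  have h2 : 0 ≤ -l := by linarith
  have : 0 ≤ (s - r) * (a ^ 2 + 2 * a * (-l) + 2 * a + 2 * (-l)) / s ^ 2 := by positivity
  linarith

/-- The improved Hardy inequality with `‖x‖ ^ 2` regularized to `‖x‖ ^ 2 + ε`. -/
lemma regularized_improved_hardy {N : ℕ} (hN : 2 ≤ N) {u : EuclideanSpace ℝ (Fin N) → ℝ}
    (hu : ContDiff ℝ 1 u) (huc : HasCompactSupport u) {ε : ℝ} (hε : 0 < ε)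
    (hsupp : ∀ x ∈ tsupport u, ‖x‖ ^ 2 + ε < 1) :
    ∫⁻ x, ENNReal.ofReal (u x ^ 2 * (((N - 2 : ℝ) / 2) ^ 2 / (‖x‖ ^ 2 + ε)
        + ‖x‖ ^ 2 * (Real.log (‖x‖ ^ 2 + ε))⁻¹ ^ 2 / (‖x‖ ^ 2 + ε) ^ 2))
      ≤ ENNReal.ofReal (∫ x, ‖gradient u x‖ ^ 2) := by
  set a : ℝ := (N - 2 : ℝ) / 2 with ha_def
  have ha : 0 ≤ a := by
    have : (2 : ℝ) ≤ N := by exact_mod_cast hN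
    rw [ha_def]; linarith
  have hNa : (N : ℝ) = 2 * a + 2 := by rw [ha_def]; ring
  let H : ℝ → ℝ := fun s => (a - (Real.log s)⁻¹) / s
  let φ : EuclideanSpace ℝ (Fin N) → ℝ := fun x => u x ^ 2 * H (‖x‖ ^ 2 + ε)
  have hzero {x : EuclideanSpace ℝ (Fin N)} (hx : x ∉ tsupport u) : φ =ᶠ[𝓝 x] fun _ => 0 := by
    filter_upwards [notMem_tsupport_iff_eventuallyEq.1 hx] with y hy
    simp [φ, hy]
  have hspos (x : EuclideanSpace ℝ (Fin N)) : 0 < ‖x‖ ^ 2 + ε := by positivity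
  have hφ : ContDiff ℝ 1 φ := by
    rw [contDiff_iff_contDiffAt]
    intro x
    by_cases hx : x ∈ tsupport u
    · have hL : Real.log (‖x‖ ^ 2 + ε) ≠ 0 := (Real.log_neg (hspos x) (hsupp x hx)).ne
      have hs : ContDiffAt ℝ 1 (fun y : EuclideanSpace ℝ (Fin N) => ‖y‖ ^ 2 + ε) x :=
        ((contDiff_norm_sq ℝ).add contDiff_const).contDiffAt
      exact (hu.contDiffAt.pow 2).mul
        ((contDiffAt_const.sub ((hs.log (hspos x).ne').inv hL)).div hs (hspos x).ne')
    · exact contDiffAt_const.congr_of_eventuallyEq (hzero hx)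
  have hφc : HasCompactSupport φ :=
    huc.mono fun x hx h => hx (by simp only [φ, show u x = 0 from h]; ring)
  have hφint : Integrable φ := hφ.continuous.integrable_of_hasCompactSupport hφc
  have hφ'int : Integrable fun x => fderiv ℝ φ x x := by
    have hcont : Continuous (fderiv ℝ φ) := hφ.continuous_fderiv one_ne_zero
    refine Continuous.integrable_of_hasCompactSupport (by fun_prop)
      ((hφc.fderiv (𝕜 := ℝ)).mono fun x hx h => hx ?_)
    simp [show fderiv ℝ φ x = 0 from h]
  have hgrad (x : EuclideanSpace ℝ (Fin N)) : ‖gradient u x‖ = ‖fderiv ℝ u x‖ := by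
    simp [gradient]
  have hgint : Integrable fun x => ‖gradient u x‖ ^ 2 := by
    simp_rw [hgrad]
    have hcont : Continuous (fderiv ℝ u) := hu.continuous_fderiv one_ne_zero
    refine Continuous.integrable_of_hasCompactSupport (by fun_prop)
      ((huc.fderiv (𝕜 := ℝ)).mono fun x hx h => hx ?_)
    simp [show fderiv ℝ u x = 0 from h]
  have hle (x : EuclideanSpace ℝ (Fin N)) :
      u x ^ 2 * (a ^ 2 / (‖x‖ ^ 2 + ε)
        + ‖x‖ ^ 2 * (Real.log (‖x‖ ^ 2 + ε))⁻¹ ^ 2 / (‖x‖ ^ 2 + ε) ^ 2)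
      ≤ ‖gradient u x‖ ^ 2 + (fderiv ℝ φ x x + N * φ x) := by
    by_cases hx : x ∈ tsupport u
    · have hs1 := hsupp x hx
      have hH : HasFDerivAt (fun y : EuclideanSpace ℝ (Fin N) => H (‖y‖ ^ 2 + ε)) _ x :=
        HasDerivAt.comp_hasFDerivAt (h₂ := H) x (hasDerivAt_hardyField a (hspos x) hs1)
          ((hasStrictFDerivAt_norm_sq x).hasFDerivAt.add_const ε)
      have hderiv : HasFDerivAt φ _ x :=
        ((hu.differentiable one_ne_zero x).hasFDerivAt.pow 2).mul hH
      have hpot := hardy_potential_le ha (hspos x) (le_add_of_nonneg_right hε.le)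
        (inv_nonpos.2 (Real.log_neg (hspos x) hs1).le)
      have hcs : |fderiv ℝ u x x| ≤ ‖gradient u x‖ * ‖x‖ := by
        rw [hgrad]; exact (fderiv ℝ u x).le_opNorm x
      have hval : fderiv ℝ φ x x = 2 * u x * fderiv ℝ u x x * H (‖x‖ ^ 2 + ε) + u x ^ 2 *
          (2 * ‖x‖ ^ 2 * (((Real.log (‖x‖ ^ 2 + ε))⁻¹ ^ 2 + (Real.log (‖x‖ ^ 2 + ε))⁻¹ - a)
            / (‖x‖ ^ 2 + ε) ^ 2)) := by
        rw [hderiv.fderiv]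
        simp
        ring
      have hsquare : 0 ≤ ‖gradient u x‖ ^ 2 + 2 * (u x * H (‖x‖ ^ 2 + ε)) * fderiv ℝ u x x
          + (u x * H (‖x‖ ^ 2 + ε)) ^ 2 * ‖x‖ ^ 2 := by
        generalize u x * H (‖x‖ ^ 2 + ε) = c
        have h1 : |c * fderiv ℝ u x x| ≤ |c| * (‖gradient u x‖ * ‖x‖) := by
          rw [abs_mul]
          exact mul_le_mul_of_nonneg_left hcs (abs_nonneg c)
        nlinarith [neg_abs_le (c * fderiv ℝ u x x), sq_nonneg (‖gradient u x‖ - |c| * ‖x‖),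
          sq_abs c]
      have hpot' := mul_le_mul_of_nonneg_left hpot (sq_nonneg (u x))
      refine hpot'.trans ?_
      rw [hval, hNa, ← sub_nonneg]
      refine hsquare.trans_eq ?_
      simp only [φ, H]
      ring
    · have h0 : u x = 0 := image_eq_zero_of_notMem_tsupport hx
      have hd : fderiv ℝ φ x = 0 := by rw [(hzero hx).fderiv_eq]; simp
      simp [φ, h0, hd]
  have hnonneg (x : EuclideanSpace ℝ (Fin N)) :
      0 ≤ u x ^ 2 * (a ^ 2 / (‖x‖ ^ 2 + ε)
        + ‖x‖ ^ 2 * (Real.log (‖x‖ ^ 2 + ε))⁻¹ ^ 2 / (‖x‖ ^ 2 + ε) ^ 2) := by positivity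
  have hbound : Integrable fun x => fderiv ℝ φ x x + N * φ x := hφ'int.add (hφint.const_mul _)
  have htotal : ∫ x, (‖gradient u x‖ ^ 2 + (fderiv ℝ φ x x + N * φ x))
      = ∫ x, ‖gradient u x‖ ^ 2 := by
    rw [integral_add hgint hbound, integral_add hφ'int (hφint.const_mul _),
      integral_fderiv_apply_self hφ hφc, integral_const_mul]
    ring
  have hsumint : Integrable fun x => ‖gradient u x‖ ^ 2 + (fderiv ℝ φ x x + N * φ x) :=
    hgint.add hbound
  rw [← htotal, ofReal_integral_eq_lintegral_ofReal hsumint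
    (ae_of_all _ fun x => (hnonneg x).trans (hle x))]
  exact lintegral_mono fun x => ENNReal.ofReal_le_ofReal (hle x)

/-- The improved Hardy inequality on the unit ball. -/
lemma improved_hardy_unit_ball {N : ℕ} (hN : 2 ≤ N) {u : EuclideanSpace ℝ (Fin N) → ℝ}
    (hu : ContDiff ℝ 1 u) (huc : HasCompactSupport u)
    (hsupp : tsupport u ⊆ ball (0 : EuclideanSpace ℝ (Fin N)) 1) :
    ∫⁻ x, ENNReal.ofReal (u x ^ 2 * (((N - 2 : ℝ) / 2) ^ 2 / ‖x‖ ^ 2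
        + 1 / (4 * ‖x‖ ^ 2 * Real.log ‖x‖ ^ 2)))
      ≤ ENNReal.ofReal (∫ x, ‖gradient u x‖ ^ 2) := by
  have : Nonempty (Fin N) := ⟨⟨0, by omega⟩⟩
  set a : ℝ := (N - 2 : ℝ) / 2
  obtain ⟨r, hr1, hr⟩ : ∃ r < 1, ∀ x ∈ tsupport u, ‖x‖ ^ 2 ≤ r := by
    rcases (tsupport u).eq_empty_or_nonempty with he | hne
    · exact ⟨0, one_pos, by simp [he]⟩
    · obtain ⟨y, hy, hmax⟩ := huc.isCompact.exists_isMaxOn hne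
        (f := fun x => ‖x‖ ^ 2) (by fun_prop)
      refine ⟨‖y‖ ^ 2, ?_, fun x hx => hmax hx⟩
      have := mem_ball_zero_iff.1 (hsupp hy)
      exact pow_lt_one₀ (norm_nonneg y) this two_ne_zero
  let g : ℝ → EuclideanSpace ℝ (Fin N) → ℝ≥0∞ := fun ε x =>
    ENNReal.ofReal (u x ^ 2 * (a ^ 2 / (‖x‖ ^ 2 + ε)
        + ‖x‖ ^ 2 * (Real.log (‖x‖ ^ 2 + ε))⁻¹ ^ 2 / (‖x‖ ^ 2 + ε) ^ 2))
  have hlim : ∀ x : EuclideanSpace ℝ (Fin N), x ≠ 0 →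
      Tendsto (fun ε => g ε x) (𝓝[>] 0) (𝓝 (ENNReal.ofReal (u x ^ 2 * (a ^ 2 / ‖x‖ ^ 2
        + 1 / (4 * ‖x‖ ^ 2 * Real.log ‖x‖ ^ 2))))) := by
    intro x hx0
    refine ENNReal.tendsto_ofReal ?_
    by_cases hx : x ∈ tsupport u
    · have hpos : 0 < ‖x‖ := norm_pos_iff.2 hx0
      have hlog : Real.log ‖x‖ < 0 := Real.log_neg hpos (mem_ball_zero_iff.1 (hsupp hx))
      have hs : Tendsto (fun ε : ℝ => ‖x‖ ^ 2 + ε) (𝓝[>] 0) (𝓝 (‖x‖ ^ 2)) := by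
        have : ContinuousAt (fun ε : ℝ => ‖x‖ ^ 2 + ε) 0 := by fun_prop
        simpa [ContinuousAt] using this.tendsto.mono_left nhdsWithin_le_nhds
      have hne : ‖x‖ ^ 2 ≠ 0 := by positivity
      have hL : Real.log (‖x‖ ^ 2) ≠ 0 := by
        rw [Real.log_pow]; push_cast; nlinarith
      have h := ((tendsto_const_nhds (x := a ^ 2)).div hs hne).add
        ((((hs.log hne).inv₀ hL).pow 2).const_mul (‖x‖ ^ 2) |>.div (hs.pow 2) (pow_ne_zero 2 hne))
      have hval : a ^ 2 / ‖x‖ ^ 2 + 1 / (4 * ‖x‖ ^ 2 * Real.log ‖x‖ ^ 2) = a ^ 2 / ‖x‖ ^ 2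
          + ‖x‖ ^ 2 * (Real.log (‖x‖ ^ 2))⁻¹ ^ 2 / (‖x‖ ^ 2) ^ 2 := by
        rw [Real.log_pow]
        push_cast
        field_simp
        ring
      rw [hval]
      exact h.const_mul (u x ^ 2)
    · simp [image_eq_zero_of_notMem_tsupport hx]
  calc _ = ∫⁻ x, liminf (fun ε => g ε x) (𝓝[>] 0) := by
        refine lintegral_congr_ae ?_
        filter_upwards [compl_mem_ae_iff.2 (measure_singleton (0 : EuclideanSpace ℝ (Fin N)))]
          with x hx
        exact ((hlim x hx).liminf_eq).symm
    _ ≤ liminf (fun ε => ∫⁻ x, g ε x) (𝓝[>] 0) := by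
        refine lintegral_liminf_le fun ε => ?_
        have := hu.continuous.measurable
        fun_prop
    _ ≤ _ := by
        refine liminf_le_of_frequently_le' (Eventually.frequently ?_)
        filter_upwards [Ioo_mem_nhdsGT (sub_pos.2 hr1)] with ε hε
        exact regularized_improved_hardy hN hu huc hε.1 fun x hx => by
          linarith [hr x hx, hε.2]

/-- Scaled improved Hardy inequality: if `U ≤ 1/(4|x|²(log|x|)²)` on `B_{R₀}` with
`R₀ ∈ (0,1]`, then `∫ U u² ≤ ∫ |∇u|² - c₀(N) ∫ u²/|x|²` for all `u ∈ C_c^∞(B_{R₀})`. -/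
theorem improved_hardy_scaled (N : ℕ) (hN : 3 ≤ N) (R₀ : ℝ) (hR₀ : 0 < R₀) (hR₀' : R₀ ≤ 1)
    (U : EuclideanSpace ℝ (Fin N) → ℝ)
    (hU : ∀ x ∈ ball (0 : EuclideanSpace ℝ (Fin N)) R₀, x ≠ 0 →
      U x ≤ 1 / (4 * ‖x‖ ^ 2 * Real.log ‖x‖ ^ 2))
    (u : EuclideanSpace ℝ (Fin N) → ℝ)
    (hu : ContDiff ℝ (⊤ : ℕ∞) u) (huc : HasCompactSupport u)
    (hsupp : tsupport u ⊆ ball (0 : EuclideanSpace ℝ (Fin N)) R₀) :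
    (∫ x in ball (0 : EuclideanSpace ℝ (Fin N)) R₀, U x * u x ^ 2) ≤
      (∫ x in ball (0 : EuclideanSpace ℝ (Fin N)) R₀, ‖gradient u x‖ ^ 2)
        - ((N - 2 : ℝ) / 2) ^ 2 *
            ∫ x in ball (0 : EuclideanSpace ℝ (Fin N)) R₀, u x ^ 2 / ‖x‖ ^ 2 := by
  set a : ℝ := (N - 2 : ℝ) / 2
  have hu1 : ContDiff ℝ 1 u := hu.of_le (m := 1) (by exact_mod_cast le_top)
  have hhardy := improved_hardy_unit_ball (by omega) hu1 huc (hsupp.trans (ball_subset_ball hR₀'))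
  have hmeas : Measurable u := hu.continuous.measurable
  have hnonneg (x : EuclideanSpace ℝ (Fin N)) : 0 ≤ u x ^ 2 * (a ^ 2 / ‖x‖ ^ 2
      + 1 / (4 * ‖x‖ ^ 2 * Real.log ‖x‖ ^ 2)) := by positivity
  have hint : Integrable fun x : EuclideanSpace ℝ (Fin N) => u x ^ 2 * (a ^ 2 / ‖x‖ ^ 2
      + 1 / (4 * ‖x‖ ^ 2 * Real.log ‖x‖ ^ 2)) := by
    refine ⟨Measurable.aestronglyMeasurable (by fun_prop), ?_⟩
    rw [hasFiniteIntegral_iff_ofReal (ae_of_all _ hnonneg)]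
    exact hhardy.trans_lt ENNReal.ofReal_lt_top
  have hle : ∫ x : EuclideanSpace ℝ (Fin N),
      u x ^ 2 * (a ^ 2 / ‖x‖ ^ 2 + 1 / (4 * ‖x‖ ^ 2 * Real.log ‖x‖ ^ 2))
      ≤ ∫ x, ‖gradient u x‖ ^ 2 := by
    rw [← ENNReal.ofReal_le_ofReal_iff (integral_nonneg fun x => by positivity),
      ofReal_integral_eq_lintegral_ofReal hint (ae_of_all _ hnonneg)]
    exact hhardy
  have hout (x : EuclideanSpace ℝ (Fin N)) (hx : x ∉ ball (0 : EuclideanSpace ℝ (Fin N)) R₀) :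
      u x = 0 :=
    image_eq_zero_of_notMem_tsupport fun h => hx (hsupp h)
  have hgout (x : EuclideanSpace ℝ (Fin N)) (hx : x ∉ ball (0 : EuclideanSpace ℝ (Fin N)) R₀) :
      ‖gradient u x‖ ^ 2 = 0 := by
    have h : fderiv ℝ u x = 0 := by
      rw [(notMem_tsupport_iff_eventuallyEq.1 fun h => hx (hsupp h)).fderiv_eq]
      simp
    simp [gradient, h]
  rw [setIntegral_eq_integral_of_forall_compl_eq_zero fun x hx => by simp [hout x hx],
    setIntegral_eq_integral_of_forall_compl_eq_zero hgout,
    setIntegral_eq_integral_of_forall_compl_eq_zero fun x hx => by simp [hout x hx]]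
  have hint1 : Integrable fun x : EuclideanSpace ℝ (Fin N) => a ^ 2 * (u x ^ 2 / ‖x‖ ^ 2) := by
    refine hint.mono' (Measurable.aestronglyMeasurable (by fun_prop)) (ae_of_all _ fun x => ?_)
    rw [Real.norm_of_nonneg (by positivity), mul_add]
    have : 0 ≤ u x ^ 2 * (1 / (4 * ‖x‖ ^ 2 * Real.log ‖x‖ ^ 2)) := by positivity
    linarith [show a ^ 2 * (u x ^ 2 / ‖x‖ ^ 2) = u x ^ 2 * (a ^ 2 / ‖x‖ ^ 2) by ring]
  have hint2 : Integrable fun x : EuclideanSpace ℝ (Fin N) =>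
      u x ^ 2 * (1 / (4 * ‖x‖ ^ 2 * Real.log ‖x‖ ^ 2)) := by
    refine hint.mono' (Measurable.aestronglyMeasurable (by fun_prop)) (ae_of_all _ fun x => ?_)
    rw [Real.norm_of_nonneg (by positivity), mul_add]
    have : 0 ≤ u x ^ 2 * (a ^ 2 / ‖x‖ ^ 2) := by positivity
    linarith
  have hsplit : ∫ x : EuclideanSpace ℝ (Fin N),
      u x ^ 2 * (a ^ 2 / ‖x‖ ^ 2 + 1 / (4 * ‖x‖ ^ 2 * Real.log ‖x‖ ^ 2))
      = a ^ 2 * (∫ x : EuclideanSpace ℝ (Fin N), u x ^ 2 / ‖x‖ ^ 2)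
        + ∫ x : EuclideanSpace ℝ (Fin N), u x ^ 2 * (1 / (4 * ‖x‖ ^ 2 * Real.log ‖x‖ ^ 2)) := by
    rw [← integral_const_mul, ← integral_add hint1 hint2]
    exact integral_congr_ae (ae_of_all _ fun x => by ring)
  have hU' : ∫ x, U x * u x ^ 2
      ≤ ∫ x : EuclideanSpace ℝ (Fin N), u x ^ 2 * (1 / (4 * ‖x‖ ^ 2 * Real.log ‖x‖ ^ 2)) := by
    by_cases hUint : Integrable fun x => U x * u x ^ 2
    · refine integral_mono_ae hUint hint2 ?_
      have : Nonempty (Fin N) := ⟨⟨0, by omega⟩⟩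
      filter_upwards [compl_mem_ae_iff.2 (measure_singleton (0 : EuclideanSpace ℝ (Fin N)))] with x hx0
      by_cases hx : x ∈ ball (0 : EuclideanSpace ℝ (Fin N)) R₀
      · rw [mul_comm]
        exact mul_le_mul_of_nonneg_left (hU x hx hx0) (sq_nonneg _)
      · simp [hout x hx]
    · rw [integral_undef hUint]
      exact integral_nonneg fun x => by positivity
  linarith
end
end

section
/- Let θ: ℝ → ℝ, θ_0(s) = e^{-1/(1-s^2)} for |s| < 1 and θ_0(s) = 0 for |s| ≥ 1. Then θ_0 is C^∞ on ℝ, 0 ≤ θ_0 ≤ 1, and the function (1/2)(θ_0')^2/θ_0 - θ_0'' is bounded above on (-1,1). -/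
open MeasureTheory Metric Filter Set

noncomputable section

/-- The standard bump function `θ₀(s) = e^{-1/(1-s²)}` for `|s| < 1`, `0` otherwise. -/
def theta0 (s : ℝ) : ℝ := if |s| < 1 then Real.exp (-(1 / (1 - s ^ 2))) else 0

theorem theta0_eq_expNegInvGlue (s : ℝ) : theta0 s = expNegInvGlue (1 - s ^ 2) := by
  have h : |s| < 1 ↔ ¬ 1 - s ^ 2 ≤ 0 := by
    rw [← sq_lt_one_iff_abs_lt_one, not_le, sub_pos]
  by_cases hs : |s| < 1
  · simp [theta0, expNegInvGlue, hs, h.1 hs]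
  · simp only [theta0, hs, if_false]
    exact (expNegInvGlue.zero_of_nonpos (by simpa using mt h.2 hs)).symm

theorem contDiff_theta0 : ContDiff ℝ (⊤ : ℕ∞) theta0 := by
  rw [funext theta0_eq_expNegInvGlue]
  exact expNegInvGlue.contDiff.comp (by fun_prop)

theorem theta0_nonneg (s : ℝ) : 0 ≤ theta0 s := by
  rw [theta0_eq_expNegInvGlue]
  exact expNegInvGlue.nonneg _

theorem one_sub_sq_pos {s : ℝ} (hs : s ∈ Ioo (-1 : ℝ) 1) : 0 < 1 - s ^ 2 := by
  nlinarith [hs.1, hs.2]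

theorem theta0_of_mem_Ioo {s : ℝ} (hs : s ∈ Ioo (-1 : ℝ) 1) :
    theta0 s = Real.exp (-(1 / (1 - s ^ 2))) :=
  if_pos (abs_lt.2 hs)

theorem theta0_le_one (s : ℝ) : theta0 s ≤ 1 := by
  unfold theta0
  split_ifs with hs
  · have := one_sub_sq_pos (abs_lt.1 hs)
    exact Real.exp_le_one_iff.2 (neg_nonpos.2 (by positivity))
  · exact zero_le_one

theorem hasDerivAt_theta0 {s : ℝ} (hs : s ∈ Ioo (-1 : ℝ) 1) :
    HasDerivAt theta0 (-(2 * s) / (1 - s ^ 2) ^ 2 * theta0 s) s := by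
  have hu := (one_sub_sq_pos hs).ne'
  have hd : HasDerivAt (fun x : ℝ => 1 - x ^ 2) (-(2 * s)) s := by
    simpa using (hasDerivAt_pow 2 s).const_sub 1
  have he := (hd.fun_inv hu).fun_neg.exp
  refine (he.congr_of_eventuallyEq ?_).congr_deriv ?_
  · filter_upwards [isOpen_Ioo.mem_nhds hs] with x hx
    rw [theta0_of_mem_Ioo hx, one_div]
  · rw [theta0_of_mem_Ioo hs, one_div]
    ring

theorem deriv_deriv_theta0 {s : ℝ} (hs : s ∈ Ioo (-1 : ℝ) 1) :
    deriv (deriv theta0) s =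
      (4 * s ^ 2 / (1 - s ^ 2) ^ 4 - 2 / (1 - s ^ 2) ^ 2 - 8 * s ^ 2 / (1 - s ^ 2) ^ 3) *
        theta0 s := by
  have hu := (one_sub_sq_pos hs).ne'
  have hd : HasDerivAt (fun x : ℝ => 1 - x ^ 2) (-(2 * s)) s := by
    simpa using (hasDerivAt_pow 2 s).const_sub 1
  have hn : HasDerivAt (fun x : ℝ => -(2 * x)) (-2) s := by
    simpa using ((hasDerivAt_id' s).const_mul 2).fun_neg
  have hp := (hn.fun_div (hd.fun_pow 2) (pow_ne_zero 2 hu)).fun_mul (hasDerivAt_theta0 hs)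
  have heq : deriv theta0 =ᶠ[nhds s] fun x => -(2 * x) / (1 - x ^ 2) ^ 2 * theta0 x := by
    filter_upwards [isOpen_Ioo.mem_nhds hs] with x hx
    exact (hasDerivAt_theta0 hx).deriv
  rw [heq.deriv_eq, hp.deriv]
  field_simp
  ring

theorem pow_mul_exp_neg_le_factorial {t : ℝ} (ht : 0 ≤ t) (n : ℕ) :
    t ^ n * Real.exp (-t) ≤ n.factorial := by
  have h := Real.pow_div_factorial_le_exp t ht n
  rw [div_le_iff₀ (by positivity)] at h
  rw [Real.exp_neg, ← div_eq_mul_inv, div_le_iff₀ (Real.exp_pos t)]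
  linarith

theorem half_deriv_sq_div_theta0_sub_le {s : ℝ} (hs : s ∈ Ioo (-1 : ℝ) 1) :
    (1 / 2) * (deriv theta0 s) ^ 2 / theta0 s - deriv (deriv theta0) s ≤ 52 := by
  have hu := one_sub_sq_pos hs
  have hθ : 0 < theta0 s := by
    rw [theta0_of_mem_Ioo hs]
    exact Real.exp_pos _
  have ht : 0 ≤ 1 / (1 - s ^ 2) := by positivity
  have h₂ := pow_mul_exp_neg_le_factorial ht 2
  have h₃ := pow_mul_exp_neg_le_factorial ht 3
  rw [← theta0_of_mem_Ioo hs] at h₂ h₃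
  norm_num [Nat.factorial] at h₂ h₃
  rw [(hasDerivAt_theta0 hs).deriv, deriv_deriv_theta0 hs]
  have key : (1 / 2) * (-(2 * s) / (1 - s ^ 2) ^ 2 * theta0 s) ^ 2 / theta0 s -
      (4 * s ^ 2 / (1 - s ^ 2) ^ 4 - 2 / (1 - s ^ 2) ^ 2 - 8 * s ^ 2 / (1 - s ^ 2) ^ 3) *
        theta0 s =
      2 * (((1 - s ^ 2) ^ 2)⁻¹ * theta0 s) + 8 * (s ^ 2 * (((1 - s ^ 2) ^ 3)⁻¹ * theta0 s)) -
        2 * s ^ 2 * ((1 - s ^ 2) ^ 4)⁻¹ * theta0 s := by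
    field_simp
    ring
  have hs₂ : s ^ 2 * (((1 - s ^ 2) ^ 3)⁻¹ * theta0 s) ≤ ((1 - s ^ 2) ^ 3)⁻¹ * theta0 s :=
    mul_le_of_le_one_left (by positivity) (by linarith)
  have h₄ : 0 ≤ 2 * s ^ 2 * ((1 - s ^ 2) ^ 4)⁻¹ * theta0 s := by positivity
  rw [key]
  linarith

/-- `θ₀` is smooth, takes values in `[0,1]`, and `(1/2)(θ₀')²/θ₀ - θ₀''` is bounded
above on `(-1, 1)`. -/
theorem theta0_properties :
    ContDiff ℝ (⊤ : ℕ∞) theta0 ∧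
    (∀ s, 0 ≤ theta0 s ∧ theta0 s ≤ 1) ∧
    ∃ M : ℝ, ∀ s ∈ Set.Ioo (-1 : ℝ) 1,
      (1 / 2) * (deriv theta0 s) ^ 2 / theta0 s - deriv (deriv theta0) s ≤ M := by
  exact ⟨contDiff_theta0, fun s => ⟨theta0_nonneg s, theta0_le_one s⟩, 52,
    fun _ hs => half_deriv_sq_div_theta0_sub_le hs⟩
end
end
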